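/- Let D₀ > 0, α > 0, c > 0 and C_f > 0. Let f : ℝ^d → ℝ be α-Hölder continuous with constant C_f, i.e. |f(x) − f(y)| ≤ C_f·|x − y|^α for all x, y. Let x ∈ ℝ^d and let Z be an ℝ^d-valued random variable with |Z| ≤ D₀ almost surely and P(|Z| > R) ≤ c·ε/R for all 0 < R ≤ D₀, where 0 < ε ≤ D₀^{2α+1}. Then ‖f(x + Z) − f(x)‖_{L²(Ω)}² = E[|f(x + Z) − f(x)|²] ≤ C_f² · (1 + c·D₀^{2α}) · ε^{2α/(2α+1)}. In particular, the multilevel estimator differences satisfy ‖Y_ℓ − Y_{ℓ−1}‖_{L²(Ω)}² = O(ε_ℓ^{2α/(2α+1)}). -/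

import Mathlib

open MeasureTheory ProbabilityTheory

/-- **Variance convergence rate of the multilevel estimator differences.**
Let `f : ℝ^d → ℝ` be `α`-Hölder with constant `C_f`, and let `Z` be an `ℝ^d`-valued
displacement with `‖Z‖ ≤ D₀` almost surely and divergence probability
`P(‖Z‖ > R) ≤ c·ε/R` for all `0 < R ≤ D₀`, where `0 < ε ≤ D₀^(2α+1)`. Then
`E[|f(x + Z) − f(x)|²] ≤ C_f²·(1 + c·D₀^(2α))·ε^(2α/(2α+1))`,
i.e. `‖Y_ℓ − Y_{ℓ−1}‖_{L²}² = O(ε_ℓ^(2α/(2α+1)))`. -/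
theorem mlwos_variance_convergence
    {Ω : Type*} [MeasureSpace Ω] [IsProbabilityMeasure (ℙ : Measure Ω)]
    (d : ℕ) (D₀ α c Cf : ℝ) (hD₀ : 0 < D₀) (hα : 0 < α) (hc : 0 < c) (hCf : 0 < Cf)
    (f : EuclideanSpace ℝ (Fin d) → ℝ)
    (hHolder : ∀ x y : EuclideanSpace ℝ (Fin d), |f x - f y| ≤ Cf * ‖x - y‖ ^ α)
    (x : EuclideanSpace ℝ (Fin d))
    (Z : Ω → EuclideanSpace ℝ (Fin d)) (hZmeas : Measurable Z)
    (hbound : ∀ᵐ ω ∂ℙ, ‖Z ω‖ ≤ D₀)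
    (ε : ℝ) (hε : 0 < ε) (hεD : ε ≤ D₀ ^ (2 * α + 1))
    (htail : ∀ R : ℝ, 0 < R → R ≤ D₀ → (ℙ {ω | R < ‖Z ω‖}).toReal ≤ c * ε / R) :
    (∫ ω, |f (x + Z ω) - f x| ^ 2 ∂ℙ)
      ≤ Cf ^ 2 * (1 + c * D₀ ^ (2 * α)) * ε ^ (2 * α / (2 * α + 1)) := by
  have h2 : 0 < 2 * α + 1 := by linarith
  obtain ⟨R, hR⟩ : ∃ R : ℝ, R = ε ^ (1 / (2 * α + 1)) := ⟨_, rfl⟩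
  have hRpos : 0 < R := by rw [hR]; exact Real.rpow_pos_of_pos hε _
  have hRD : R ≤ D₀ := by
    have h := Real.rpow_le_rpow hε.le hεD (by positivity : 0 ≤ 1 / (2 * α + 1))
    rw [← Real.rpow_mul hD₀.le, mul_one_div_cancel h2.ne', Real.rpow_one] at h
    rw [hR]; exact h
  have hR2 : R ^ (2 * α) = ε ^ (2 * α / (2 * α + 1)) := by
    rw [hR, ← Real.rpow_mul hε.le]; congr 1; field_simp
  have hεR : ε / R = ε ^ (2 * α / (2 * α + 1)) := by
    rw [hR]
    nth_rewrite 1 [← Real.rpow_one ε]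
    rw [← Real.rpow_sub hε]; congr 1; field_simp; ring
  have hmeas : MeasurableSet {ω | R < ‖Z ω‖} :=
    measurableSet_lt measurable_const hZmeas.norm
  have hpt : ∀ (ω : Ω) (r : ℝ), ‖Z ω‖ ≤ r →
      |f (x + Z ω) - f x| ^ 2 ≤ Cf ^ 2 * r ^ (2 * α) := by
    intro ω r hr
    have h1 := hHolder (x + Z ω) x
    rw [add_sub_cancel_left] at h1
    have h3 : ‖Z ω‖ ^ α ≤ r ^ α := Real.rpow_le_rpow (norm_nonneg _) hr hα.le
    have h4 : |f (x + Z ω) - f x| ≤ Cf * r ^ α :=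
      h1.trans (mul_le_mul_of_nonneg_left h3 hCf.le)
    have h5 : r ^ (2 * α) = (r ^ α) ^ 2 := by
      rw [mul_comm, Real.rpow_mul ((norm_nonneg _).trans hr)]; norm_cast
    rw [h5, ← mul_pow]
    exact pow_le_pow_left₀ (abs_nonneg _) h4 2
  have hint : Integrable ({ω | R < ‖Z ω‖}.indicator
      (fun _ : Ω => Cf ^ 2 * D₀ ^ (2 * α))) ℙ :=
    (integrable_const _).indicator hmeas
  have key : (∫ ω, |f (x + Z ω) - f x| ^ 2 ∂ℙ) ≤
      ∫ ω, (Cf ^ 2 * R ^ (2 * α) + {ω | R < ‖Z ω‖}.indicator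
        (fun _ : Ω => Cf ^ 2 * D₀ ^ (2 * α)) ω) ∂ℙ := by
    apply integral_mono_of_nonneg
    · exact Filter.Eventually.of_forall fun ω => by positivity
    · exact (integrable_const _).add hint
    · filter_upwards [hbound] with ω hω
      by_cases h : R < ‖Z ω‖
      · rw [Set.indicator_of_mem (by exact h)]
        have := hpt ω D₀ hω
        have : 0 ≤ Cf ^ 2 * R ^ (2 * α) := by positivity
        linarith
      · rw [Set.indicator_of_notMem (by exact h), add_zero]
        exact hpt ω R (not_lt.mp h)
  rw [integral_add (integrable_const _) hint, integral_indicator_const _ hmeas,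
    integral_const] at key
  simp only [probReal_univ, smul_eq_mul, one_mul] at key
  have ht := htail R hRpos hRD
  rw [mul_div_assoc, hεR] at ht
  rw [hR2] at key
  have hm := mul_le_mul_of_nonneg_right ht (by positivity : 0 ≤ Cf ^ 2 * D₀ ^ (2 * α))
  refine key.trans ((add_le_add_right hm _).trans (le_of_eq ?_))
  ring
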